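/- arXiv:quant-ph/0601009 — 3 statements merged into one kernel-verified Lean document; each statement's English description precedes it below -/
import Mathlib

section
/- For every positive operator measure E : 𝒜 → L(H) and every measurable function f : Ω → ℂ, the set D²(f,E) is a linear subspace of D(f,E); that is, if |f|² is E_{φ,φ}-integrable then f is E_{ψ,φ}-integrable for every ψ ∈ H. -/
open MeasureTheory Filter Topology ComplexConjugate

noncomputable section

local notation "⟪" x ", " y "⟫" => @inner ℂ _ _ x y

/-- The total variation measure of a complex measure. -/
def MeasureTheory.ComplexMeasure.tv {Ω : Type*} [MeasurableSpace Ω]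
    (ν : MeasureTheory.ComplexMeasure Ω) : MeasureTheory.Measure Ω :=
  (MeasureTheory.ComplexMeasure.re ν).totalVariation +
    (MeasureTheory.ComplexMeasure.im ν).totalVariation

/-- `f` is integrable with respect to the complex measure `ν`: it is integrable with respect
to the total variation measure of `ν`. -/
def MeasureTheory.ComplexMeasure.CIntegrable {Ω : Type*} [MeasurableSpace Ω]
    (ν : MeasureTheory.ComplexMeasure Ω) (f : Ω → ℂ) : Prop :=
  MeasureTheory.Integrable f ν.tv

/-- The integral of a complex function against a signed measure. -/
def MeasureTheory.SignedMeasure.cintegral {Ω : Type*} [MeasurableSpace Ω]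
    (σ : MeasureTheory.SignedMeasure Ω) (f : Ω → ℂ) : ℂ :=
  (∫ x, f x ∂σ.toJordanDecomposition.posPart) - ∫ x, f x ∂σ.toJordanDecomposition.negPart

/-- The integral of a complex function against a complex measure. -/
def MeasureTheory.ComplexMeasure.cintegral {Ω : Type*} [MeasurableSpace Ω]
    (ν : MeasureTheory.ComplexMeasure Ω) (f : Ω → ℂ) : ℂ :=
  (MeasureTheory.ComplexMeasure.re ν).cintegral f +
    Complex.I * (MeasureTheory.ComplexMeasure.im ν).cintegral f

open scoped NNReal ENNReal

theorem MeasureTheory.SignedMeasure.smul_totalVariation_le {Ω : Type*} [MeasurableSpace Ω]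
    (σ : SignedMeasure Ω) (c : ℝ≥0) (τ : Measure Ω) [IsFiniteMeasure τ]
    (h : ∀ B, MeasurableSet B → c * ‖σ B‖ ≤ τ.real B) : c • σ.totalVariation ≤ τ := by
  have hc : c • σ.totalVariation = ((c : ℝ) • σ).variation := by
    rw [VectorMeasure.variation_smul, SignedMeasure.totalVariation_eq_variation]
    simp
  rw [hc]
  refine VectorMeasure.variation_le_of_forall_enorm_le fun B hB => ?_
  rw [← ofReal_norm, ← ENNReal.ofReal_toReal (measure_ne_top τ B)]
  refine ENNReal.ofReal_le_ofReal ?_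
  simpa [norm_smul, measureReal_def] using h B hB

namespace MeasureTheory.ComplexMeasure

variable {Ω : Type*} [MeasurableSpace Ω]

instance (ν : ComplexMeasure Ω) : IsFiniteMeasure ν.tv := by
  unfold tv; infer_instance

theorem smul_tv_le (ν : ComplexMeasure Ω) (c : ℝ≥0) (τ : Measure Ω) [IsFiniteMeasure τ]
    (h : ∀ B, MeasurableSet B → c * ‖ν B‖ ≤ τ.real B) : c • ν.tv ≤ (2 : ℝ≥0) • τ := by
  have hre : c • (re ν).totalVariation ≤ τ :=
    SignedMeasure.smul_totalVariation_le _ c τ fun B hB =>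
      (mul_le_mul_of_nonneg_left (Complex.abs_re_le_norm (ν B)) c.2).trans (h B hB)
  have him : c • (im ν).totalVariation ≤ τ :=
    SignedMeasure.smul_totalVariation_le _ c τ fun B hB =>
      (mul_le_mul_of_nonneg_left (Complex.abs_im_le_norm (ν B)) c.2).trans (h B hB)
  rw [tv, smul_add, two_smul]
  exact add_le_add hre him

theorem re_apply_le_tv (ν : ComplexMeasure Ω) (B : Set Ω) : (ν B).re ≤ ν.tv.real B := by
  have h := (le_abs_self _).trans ((re ν).norm_le_totalVariation B)
  rw [tv, measureReal_add_apply]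
  exact h.trans (le_add_of_nonneg_right measureReal_nonneg)

end MeasureTheory.ComplexMeasure

theorem MeasureTheory.lintegral_le_lintegral_sq_add {Ω : Type*} [MeasurableSpace Ω]
    {l μ κ : Measure Ω}
    (h : ∀ (x : ℝ≥0) (B : Set Ω), MeasurableSet B → x * l B ≤ x ^ 2 * μ B + κ B)
    (f : Ω → ℝ≥0∞) : ∫⁻ x, f x ∂l ≤ ∫⁻ x, f x ^ 2 ∂μ + κ Set.univ := by
  rw [lintegral_eq_nnreal]
  refine iSup₂_le fun s hs => ?_
  calc (s.map (fun y : ℝ≥0 => (y : ℝ≥0∞))).lintegral l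
      = ∑ y ∈ s.range, (y : ℝ≥0∞) * l (s ⁻¹' {y}) := SimpleFunc.map_lintegral _ _
    _ ≤ ∑ y ∈ s.range, ((y : ℝ≥0∞) ^ 2 * μ (s ⁻¹' {y}) + κ (s ⁻¹' {y})) :=
        Finset.sum_le_sum fun y _ => h y _ (s.measurableSet_fiber y)
    _ = (s.map (fun y : ℝ≥0 => (y : ℝ≥0∞) ^ 2)).lintegral μ + κ Set.univ := by
        rw [Finset.sum_add_distrib, SimpleFunc.map_lintegral, s.sum_range_measure_preimage_singleton]
    _ ≤ ∫⁻ x, f x ^ 2 ∂μ + κ Set.univ := by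
        gcongr
        rw [← SimpleFunc.lintegral_eq_lintegral]
        exact lintegral_mono fun x => pow_le_pow_left' (hs x) 2

namespace ContinuousLinearMap.IsPositive

variable {H : Type*} [NormedAddCommGroup H] [InnerProductSpace ℂ H] {T : H →L[ℂ] H}

theorem norm_inner_self (hT : T.IsPositive) (φ : H) : ‖⟪φ, T φ⟫‖ = (⟪φ, T φ⟫).re :=
  (Complex.re_eq_norm.2 (hT.inner_nonneg_right φ)).symm

theorem re_inner_add_le (hT : T.IsPositive) (φ ψ : H) :
    (⟪φ + ψ, T (φ + ψ)⟫).re ≤ 2 * ((⟪φ, T φ⟫).re + (⟪ψ, T ψ⟫).re) := by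
  have h : 0 ≤ (⟪φ - ψ, T (φ - ψ)⟫).re := hT.re_inner_nonneg_right _
  simp only [map_sub, map_add, inner_sub_left, inner_sub_right, inner_add_left, inner_add_right,
    Complex.sub_re, Complex.add_re] at h ⊢
  linarith

theorem mul_norm_inner_le (hT : T.IsPositive) (φ ψ : H) {x : ℝ} (hx : 0 ≤ x) :
    x * ‖⟪ψ, T φ⟫‖ ≤ x ^ 2 * (⟪φ, T φ⟫).re + (⟪ψ, T ψ⟫).re := by
  have hφ : 0 ≤ (⟪φ, T φ⟫).re := hT.re_inner_nonneg_right _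
  have hψ : 0 ≤ (⟪ψ, T ψ⟫).re := hT.re_inner_nonneg_right _
  set z := ⟪ψ, T φ⟫ with hz
  have hz' : ⟪φ, T ψ⟫ = conj z := by
    rw [← hT.inner_left_eq_inner_right, hz, inner_conj_symm]
  rcases eq_or_ne z 0 with h0 | h0
  · rw [h0, norm_zero, mul_zero]
    positivity
  have hn : (‖z‖ : ℂ) ≠ 0 := by simpa using h0
  obtain ⟨u, hu, huz⟩ : ∃ u : ℂ, conj u * u = 1 ∧ conj u * z = ‖z‖ := by
    have hzz : conj z * z = (‖z‖ : ℂ) ^ 2 := Complex.conj_mul' z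
    refine ⟨z / ‖z‖, ?_, ?_⟩
    · rw [map_div₀, Complex.conj_ofReal]
      field_simp
      exact hzz
    · rw [map_div₀, Complex.conj_ofReal]
      field_simp
      exact hzz
  have huz' : u * conj z = ‖z‖ := by
    have := congrArg conj huz
    simpa using this
  have h : 0 ≤ (⟪(x : ℂ) • φ - u • ψ, T ((x : ℂ) • φ - u • ψ)⟫).re := hT.re_inner_nonneg_right _
  have e : ⟪(x : ℂ) • φ - u • ψ, T ((x : ℂ) • φ - u • ψ)⟫ =
      ((x ^ 2 : ℝ) : ℂ) * ⟪φ, T φ⟫ + ⟪ψ, T ψ⟫ - ((2 * x * ‖z‖ : ℝ) : ℂ) := by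
    simp only [map_sub, map_smul, inner_sub_left, inner_sub_right, inner_smul_left,
      inner_smul_right, Complex.conj_ofReal, hz', ← hz]
    push_cast
    linear_combination ⟪ψ, T ψ⟫ * hu - (x : ℂ) * huz - (x : ℂ) * huz'
  rw [e, Complex.sub_re, Complex.add_re, Complex.re_ofReal_mul, Complex.ofReal_re] at h
  have : 0 ≤ x * ‖z‖ := by positivity
  linarith

end ContinuousLinearMap.IsPositive

/-- For every positive operator measure `E` (with associated complex measures
`ν ψ φ = ⟨ψ, E(·)φ⟩`) and every measurable `f : Ω → ℂ`, the set `D²(f,E)` of vectors `φ` such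
that `|f|²` is `E_{φ,φ}`-integrable is a linear subspace of `D(f,E)`: in particular, if `|f|²`
is `E_{φ,φ}`-integrable then `f` is `E_{ψ,φ}`-integrable for every `ψ ∈ H`. -/
theorem stmt1 {Ω : Type*} [MeasurableSpace Ω] {H : Type*} [NormedAddCommGroup H]
    [InnerProductSpace ℂ H] [CompleteSpace H]
    (E : Set Ω → H →L[ℂ] H) (hEpos : ∀ B : Set Ω, MeasurableSet B → (E B).IsPositive)
    (ν : H → H → MeasureTheory.ComplexMeasure Ω)
    (hν : ∀ (ψ φ : H) (B : Set Ω), MeasurableSet B → ν ψ φ B = ⟪ψ, E B φ⟫)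
    (f : Ω → ℂ) (hf : Measurable f) :
    ∃ D2 : Submodule ℂ H,
      (D2 : Set H) = {φ : H | Integrable (fun x => ‖f x‖ ^ 2) (ν φ φ).tv} ∧
      (D2 : Set H) ⊆ {φ : H | ∀ ψ : H, (ν ψ φ).CIntegrable f} := by
  have hle : ∀ φ B, MeasurableSet B → (⟪φ, E B φ⟫).re ≤ (ν φ φ).tv.real B := fun φ B hB => by
    rw [← hν φ φ B hB]
    exact (ν φ φ).re_apply_le_tv B
  have hmono : ∀ {μ τ : Measure Ω} (c : ℝ≥0), μ ≤ c • τ →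
      Integrable (fun x => ‖f x‖ ^ 2) τ → Integrable (fun x => ‖f x‖ ^ 2) μ :=
    fun c h hi => (hi.smul_measure_nnreal (c := c)).mono_measure h
  let D2 : Submodule ℂ H :=
    { carrier := {φ : H | Integrable (fun x => ‖f x‖ ^ 2) (ν φ φ).tv}
      zero_mem' := by
        have h := (ν 0 0).smul_tv_le 1 0 fun B hB => by simp [hν 0 0 B hB]
        rw [one_smul] at h
        exact hmono 2 h integrable_zero_measure
      add_mem' := by
        intro φ ψ hφ hψ
        have h := (ν (φ + ψ) (φ + ψ)).smul_tv_le 1 ((2 : ℝ≥0) • ((ν φ φ).tv + (ν ψ ψ).tv))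
          fun B hB => by
            rw [hν _ _ B hB, (hEpos B hB).norm_inner_self, measureReal_nnreal_smul_apply,
              measureReal_add_apply]
            have := (hEpos B hB).re_inner_add_le φ ψ
            have := hle φ B hB
            have := hle ψ B hB
            rw [NNReal.coe_one, NNReal.coe_ofNat, one_mul]
            linarith
        rw [one_smul, smul_smul] at h
        exact hmono _ h (Integrable.add_measure hφ hψ)
      smul_mem' := by
        intro c φ hφ
        have h := (ν (c • φ) (c • φ)).smul_tv_le 1 ((‖c‖₊ ^ 2) • (ν φ φ).tv)
          fun B hB => by
            rw [hν _ _ B hB, map_smul, inner_smul_left, inner_smul_right, norm_mul, norm_mul,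
              (hEpos B hB).norm_inner_self, measureReal_nnreal_smul_apply, RCLike.norm_conj]
            have := mul_le_mul_of_nonneg_left (hle φ B hB) (sq_nonneg ‖c‖)
            push_cast
            linarith
        rw [one_smul, smul_smul] at h
        exact hmono _ h hφ }
  refine ⟨D2, rfl, fun φ hφ ψ => ⟨hf.aestronglyMeasurable, ?_⟩⟩
  have hφ' : Integrable (fun x => ‖f x‖ ^ 2) (ν φ φ).tv := hφ
  have key := lintegral_le_lintegral_sq_add (l := (ν ψ φ).tv) (μ := (2 : ℝ≥0) • (ν φ φ).tv)
    (κ := (2 : ℝ≥0) • (ν ψ ψ).tv) (fun x B _ => by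
      have h := (ν ψ φ).smul_tv_le x ((x ^ 2) • (ν φ φ).tv + (ν ψ ψ).tv) fun B hB => by
        rw [hν _ _ B hB, measureReal_add_apply, measureReal_nnreal_smul_apply]
        have := (hEpos B hB).mul_norm_inner_le φ ψ x.coe_nonneg
        have := mul_le_mul_of_nonneg_left (hle φ B hB) (sq_nonneg (x : ℝ))
        have := hle ψ B hB
        push_cast
        linarith
      have hB := h B
      rw [smul_add, smul_comm] at hB
      simpa only [Measure.add_apply, Measure.smul_apply, ENNReal.smul_def, smul_eq_mul,
        ENNReal.coe_pow, smul_comm (2 : ℝ≥0)] using hB) (fun x => ‖f x‖ₑ)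
  refine key.trans_lt (ENNReal.add_lt_top.2 ⟨?_, measure_lt_top _ _⟩)
  have hi := (hφ'.smul_measure_nnreal (c := 2)).2
  simpa [HasFiniteIntegral, enorm_pow] using hi
end
end

section
/- If E : 𝒜 → L(H) is a spectral measure (normalized and projection valued), then D²(f,E) = D(f,E) for every measurable function f : Ω → ℂ; that is, f is E_{ψ,φ}-integrable for every ψ ∈ H if and only if |f|² is E_{φ,φ}-integrable. -/
open MeasureTheory Filter Topology ComplexConjugate

noncomputable section

local notation "⟪" x ", " y "⟫" => @inner ℂ _ _ x y

open scoped ENNReal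

namespace MeasureTheory

lemma lintegral_comp_nat_eq_tsum {Ω : Type*} [MeasurableSpace Ω] (μ : Measure Ω) {n : Ω → ℕ}
    (hn : Measurable n) (c : ℕ → ℝ≥0∞) :
    ∫⁻ x, c (n x) ∂μ = ∑' k, c k * μ (n ⁻¹' {k}) := by
  rw [← lintegral_map (measurable_of_countable c) hn, lintegral_countable']
  exact tsum_congr fun k => by rw [Measure.map_apply hn (measurableSet_singleton k)]

namespace ComplexMeasure

variable {Ω : Type*} [MeasurableSpace Ω]

instance inst_s3 (ν : ComplexMeasure Ω) : IsFiniteMeasure ν.tv := by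
  unfold tv; infer_instance

lemma enorm_apply_le_tv (ν : ComplexMeasure Ω) (B : Set Ω) : ‖ν B‖ₑ ≤ ν.tv B := by
  have h : ν B = ((re ν B : ℝ) : ℂ) + ((im ν B : ℝ) : ℂ) * Complex.I := (Complex.re_add_im _).symm
  calc ‖ν B‖ₑ ≤ ‖((re ν B : ℝ) : ℂ)‖ₑ + ‖((im ν B : ℝ) : ℂ) * Complex.I‖ₑ := by
        rw [h]; exact enorm_add_le _ _
    _ = ‖re ν B‖ₑ + ‖im ν B‖ₑ := by
        simp only [← ofReal_norm, norm_mul, Complex.norm_I, mul_one, Complex.norm_real]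
    _ ≤ ν.tv B := by
        rw [tv, Measure.add_apply]
        exact add_le_add (SignedMeasure.enorm_le_totalVariation _ _)
          (SignedMeasure.enorm_le_totalVariation _ _)

lemma tv_le_of_forall_enorm_le {ν : ComplexMeasure Ω} {m : Measure Ω}
    (h : ∀ B, MeasurableSet B → ‖ν B‖ₑ ≤ m B) (A : Set Ω) : ν.tv A ≤ 2 * m A := by
  have hre : (re ν).totalVariation ≤ m := by
    rw [SignedMeasure.totalVariation_eq_variation]
    refine VectorMeasure.variation_le_of_forall_enorm_le fun B hB => le_trans ?_ (h B hB)
    rw [← ofReal_norm, ← ofReal_norm]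
    exact ENNReal.ofReal_le_ofReal (Complex.abs_re_le_norm _)
  have him : (im ν).totalVariation ≤ m := by
    rw [SignedMeasure.totalVariation_eq_variation]
    refine VectorMeasure.variation_le_of_forall_enorm_le fun B hB => le_trans ?_ (h B hB)
    rw [← ofReal_norm, ← ofReal_norm]
    exact ENNReal.ofReal_le_ofReal (Complex.abs_im_le_norm _)
  rw [tv, Measure.add_apply, two_mul]
  exact add_le_add (hre A) (him A)

lemma tv_apply_le_of_nonneg {ν : ComplexMeasure Ω} {r : Set Ω → ℝ} (hr : ∀ B, 0 ≤ r B)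
    (h : ∀ B, MeasurableSet B → ν B = r B) {A : Set Ω} (hA : MeasurableSet A) :
    ν.tv A ≤ 2 * ENNReal.ofReal (r A) := by
  have hre (B : Set Ω) (hB : MeasurableSet B) : re ν B = r B := by
    change (ν B).re = r B
    rw [h B hB, Complex.ofReal_re]
  have hpos : 0 ≤[Set.univ] re ν := by
    rw [VectorMeasure.le_restrict_univ_iff_le]
    intro B hB
    rw [hre B hB]
    exact hr B
  have hm (B : Set Ω) (hB : MeasurableSet B) :
      (re ν).toMeasureOfZeroLE Set.univ MeasurableSet.univ hpos B = ENNReal.ofReal (r B) := by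
    rw [← ofReal_measureReal, SignedMeasure.toMeasureOfZeroLE_real_apply _ _ _ hB, Set.univ_inter,
      hre B hB]
  rw [← hm A hA]
  refine tv_le_of_forall_enorm_le (fun B hB => ?_) A
  rw [hm B hB, h B hB, ← ofReal_norm, Complex.norm_of_nonneg (hr B)]

end ComplexMeasure

end MeasureTheory

/-- `E` is a projection valued (not necessarily normalized) measure, and `ν ψ φ` is the complex
measure `B ↦ ⟪ψ, E B φ⟫`. -/
structure IsSpectralFamily {Ω : Type*} [MeasurableSpace Ω] {H : Type*} [NormedAddCommGroup H]
    [InnerProductSpace ℂ H] [CompleteSpace H] (E : Set Ω → H →L[ℂ] H)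
    (ν : H → H → ComplexMeasure Ω) : Prop where
  isPositive : ∀ B : Set Ω, MeasurableSet B → (E B).IsPositive
  map_inter : ∀ A B : Set Ω, MeasurableSet A → MeasurableSet B → E (A ∩ B) = (E A).comp (E B)
  apply_eq : ∀ (ψ φ : H) (B : Set Ω), MeasurableSet B → ν ψ φ B = ⟪ψ, E B φ⟫

namespace IsSpectralFamily

variable {Ω : Type*} [MeasurableSpace Ω] {H : Type*} [NormedAddCommGroup H]
  [InnerProductSpace ℂ H] [CompleteSpace H] {E : Set Ω → H →L[ℂ] H}
  {ν : H → H → ComplexMeasure Ω}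

lemma inner_apply_apply (hE : IsSpectralFamily E ν) {A B : Set Ω} (hA : MeasurableSet A)
    (hB : MeasurableSet B) (ψ φ : H) : ⟪E A ψ, E B φ⟫ = ν ψ φ (A ∩ B) := by
  rw [hE.apply_eq ψ φ _ (hA.inter hB), hE.map_inter A B hA hB, ContinuousLinearMap.comp_apply]
  exact (hE.isPositive A hA).isSymmetric ψ (E B φ)

lemma apply_self (hE : IsSpectralFamily E ν) {B : Set Ω} (hB : MeasurableSet B) (φ : H) :
    ν φ φ B = ((‖E B φ‖ ^ 2 : ℝ) : ℂ) := by
  rw [← Set.inter_self B, ← hE.inner_apply_apply hB hB, Set.inter_self,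
    inner_self_eq_norm_sq_to_K]
  simp

lemma enorm_sq_le_tv (hE : IsSpectralFamily E ν) {B : Set Ω} (hB : MeasurableSet B) (φ : H) :
    ‖E B φ‖ₑ ^ 2 ≤ (ν φ φ).tv B := by
  refine le_trans (le_of_eq ?_) ((ν φ φ).enorm_apply_le_tv B)
  rw [hE.apply_self hB, ← ofReal_norm, ← ofReal_norm, Complex.norm_of_nonneg (by positivity),
    ENNReal.ofReal_pow (norm_nonneg _)]

lemma tv_le_enorm_sq (hE : IsSpectralFamily E ν) {B : Set Ω} (hB : MeasurableSet B) (φ : H) :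
    (ν φ φ).tv B ≤ 2 * ENNReal.ofReal (‖E B φ‖ ^ 2) :=
  ComplexMeasure.tv_apply_le_of_nonneg (r := fun B => ‖E B φ‖ ^ 2) (fun _ => by positivity)
    (fun _ hB => hE.apply_self hB φ) hB

lemma enorm_apply_le (hE : IsSpectralFamily E ν) {B : Set Ω} (hB : MeasurableSet B) (ψ φ : H) :
    ‖ν ψ φ B‖ₑ ≤ ‖E B ψ‖ₑ * ‖E B φ‖ₑ := by
  rw [← Set.inter_self B, ← hE.inner_apply_apply hB hB, Set.inter_self, ← ofReal_norm,
    ← ofReal_norm, ← ofReal_norm, ← ENNReal.ofReal_mul (norm_nonneg _)]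
  exact ENNReal.ofReal_le_ofReal (norm_inner_le_norm _ _)

/-- A weighted Cauchy–Schwarz inequality for the total variation of `ν ψ φ`. -/
lemma natCast_mul_tv_le (hE : IsSpectralFamily E ν) (A : Set Ω) (ψ φ : H) (k : ℕ) :
    (k : ℝ≥0∞) * (ν ψ φ).tv A ≤ 2 * ((ν ψ ψ).tv A + (k : ℝ≥0∞) ^ 2 * (ν φ φ).tv A) := by
  rcases Nat.eq_zero_or_pos k with rfl | hk
  · simp
  have hk0 : (k : ℝ≥0∞) ≠ 0 := by exact_mod_cast hk.ne'
  have hkt : (k : ℝ≥0∞) ≠ ∞ := ENNReal.natCast_ne_top k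
  have key := ComplexMeasure.tv_le_of_forall_enorm_le (ν := ν ψ φ)
    (m := (k : ℝ≥0∞)⁻¹ • (ν ψ ψ).tv + (k : ℝ≥0∞) • (ν φ φ).tv) (fun B hB => by
      rw [Measure.add_apply, Measure.smul_apply, Measure.smul_apply, smul_eq_mul, smul_eq_mul]
      refine (hE.enorm_apply_le hB ψ φ).trans ?_
      rcases le_total ‖E B ψ‖ₑ (k * ‖E B φ‖ₑ) with h | h
      · refine le_trans ?_ le_add_self
        calc ‖E B ψ‖ₑ * ‖E B φ‖ₑ ≤ k * ‖E B φ‖ₑ * ‖E B φ‖ₑ := by gcongr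
          _ = k * ‖E B φ‖ₑ ^ 2 := by ring
          _ ≤ _ := by gcongr; exact hE.enorm_sq_le_tv hB φ
      · refine le_trans ?_ le_self_add
        have h' : ‖E B φ‖ₑ ≤ (k : ℝ≥0∞)⁻¹ * ‖E B ψ‖ₑ := by
          rw [← one_mul ‖E B φ‖ₑ, ← ENNReal.inv_mul_cancel hk0 hkt, mul_assoc]
          gcongr
        calc ‖E B ψ‖ₑ * ‖E B φ‖ₑ ≤ ‖E B ψ‖ₑ * ((k : ℝ≥0∞)⁻¹ * ‖E B ψ‖ₑ) := by gcongr
          _ = (k : ℝ≥0∞)⁻¹ * ‖E B ψ‖ₑ ^ 2 := by ring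
          _ ≤ _ := by gcongr; exact hE.enorm_sq_le_tv hB ψ) A
  calc (k : ℝ≥0∞) * (ν ψ φ).tv A
      ≤ k * (2 * ((k : ℝ≥0∞)⁻¹ * (ν ψ ψ).tv A + k * (ν φ φ).tv A)) := by gcongr; exact key
    _ = 2 * ((k * (k : ℝ≥0∞)⁻¹) * (ν ψ ψ).tv A + (k : ℝ≥0∞) ^ 2 * (ν φ φ).tv A) := by ring
    _ = _ := by rw [ENNReal.mul_inv_cancel hk0 hkt, one_mul]

lemma lintegral_natCast_le (hE : IsSpectralFamily E ν) {n : Ω → ℕ} (hn : Measurable n)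
    (ψ φ : H) :
    ∫⁻ x, (n x : ℝ≥0∞) ∂(ν ψ φ).tv ≤
      2 * ((ν ψ ψ).tv Set.univ + ∫⁻ x, (n x : ℝ≥0∞) ^ 2 ∂(ν φ φ).tv) := by
  have h1 := lintegral_comp_nat_eq_tsum (ν ψ ψ).tv hn fun _ => 1
  simp only [one_mul, lintegral_const] at h1
  rw [lintegral_comp_nat_eq_tsum _ hn fun k => (k : ℝ≥0∞),
    lintegral_comp_nat_eq_tsum _ hn fun k => (k : ℝ≥0∞) ^ 2, h1, ← ENNReal.tsum_add,
    ← ENNReal.tsum_mul_left]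
  exact ENNReal.tsum_le_tsum fun k => hE.natCast_mul_tv_le _ ψ φ k

lemma norm_sum_smul_sq (hE : IsSpectralFamily E ν) {A : ℕ → Set Ω}
    (hA : ∀ k, MeasurableSet (A k)) (hd : Pairwise (Function.onFun Disjoint A)) (φ : H)
    (c : ℕ → ℂ) (N : ℕ) :
    ‖∑ k ∈ Finset.range N, c k • E (A k) φ‖ ^ 2 =
      ∑ k ∈ Finset.range N, ‖c k‖ ^ 2 * ‖E (A k) φ‖ ^ 2 := by
  induction N with
  | zero => simp
  | succ N ih =>
    rw [Finset.sum_range_succ, Finset.sum_range_succ, ← ih, sq, sq ‖Finset.sum _ _‖,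
      norm_add_sq_eq_norm_sq_add_norm_sq_of_inner_eq_zero (𝕜 := ℂ), norm_smul]
    · ring
    · rw [sum_inner]
      refine Finset.sum_eq_zero fun k hk => ?_
      rw [inner_smul_left, inner_smul_right, hE.inner_apply_apply (hA k) (hA N),
        (hd (Finset.mem_range.1 hk).ne).inter_eq, VectorMeasure.empty]
      simp

lemma lintegral_natCast_sq_lt_top (hE : IsSpectralFamily E ν) {n : Ω → ℕ} (hn : Measurable n)
    (φ : H) (h : ∀ ψ, ∫⁻ x, (n x : ℝ≥0∞) ∂(ν ψ φ).tv < ∞) :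
    ∫⁻ x, (n x : ℝ≥0∞) ^ 2 ∂(ν φ φ).tv < ∞ := by
  set A : ℕ → Set Ω := fun k => n ⁻¹' {k} with hAdef
  have hA (k : ℕ) : MeasurableSet (A k) := hn (measurableSet_singleton k)
  have hd : Pairwise (Function.onFun Disjoint A) := fun i j hij =>
    Disjoint.preimage n (Set.disjoint_singleton.2 hij)
  let S : ℕ → H := fun N => ∑ k ∈ Finset.range N, (k : ℂ) • E (A k) φ
  have hweak (ψ : H) : ∃ C, ∀ N, ‖innerSL ℂ (S N) ψ‖ ≤ C := by
    refine ⟨(∫⁻ x, (n x : ℝ≥0∞) ∂(ν ψ φ).tv).toReal, fun N => ?_⟩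
    rw [innerSL_apply_apply, norm_inner_symm]
    refine (ENNReal.ofReal_le_iff_le_toReal (h ψ).ne).1 ?_
    rw [ofReal_norm, lintegral_comp_nat_eq_tsum _ hn fun k => (k : ℝ≥0∞)]
    refine le_trans ?_ (ENNReal.sum_le_tsum (Finset.range N))
    rw [inner_sum]
    refine (enorm_sum_le _ _).trans (Finset.sum_le_sum fun k _ => ?_)
    rw [inner_smul_right, ← hE.apply_eq ψ φ _ (hA k), enorm_mul]
    gcongr
    · simp [← ofReal_norm]
    · exact (ν ψ φ).enorm_apply_le_tv _
  obtain ⟨C, hC⟩ := banach_steinhaus hweak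
  have hbound (N : ℕ) : ∑ k ∈ Finset.range N, (k : ℝ≥0∞) ^ 2 * (ν φ φ).tv (A k) ≤
      2 * ENNReal.ofReal (C ^ 2) := by
    calc ∑ k ∈ Finset.range N, (k : ℝ≥0∞) ^ 2 * (ν φ φ).tv (A k)
        ≤ ∑ k ∈ Finset.range N, 2 * ENNReal.ofReal (‖(k : ℂ)‖ ^ 2 * ‖E (A k) φ‖ ^ 2) := by
          refine Finset.sum_le_sum fun k _ => ?_
          rw [ENNReal.ofReal_mul (by positivity), Complex.norm_natCast,
            ENNReal.ofReal_pow (Nat.cast_nonneg k), ENNReal.ofReal_natCast, mul_left_comm]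
          gcongr
          exact hE.tv_le_enorm_sq (hA k) φ
      _ = 2 * ENNReal.ofReal (‖S N‖ ^ 2) := by
          rw [← Finset.mul_sum, ← ENNReal.ofReal_sum_of_nonneg fun _ _ => by positivity,
            ← hE.norm_sum_smul_sq hA hd]
      _ ≤ 2 * ENNReal.ofReal (C ^ 2) := by
          have := hC N
          rw [innerSL_apply_norm] at this
          gcongr
  rw [lintegral_comp_nat_eq_tsum _ hn fun k => (k : ℝ≥0∞) ^ 2]
  refine lt_of_le_of_lt (ENNReal.tsum_le_of_sum_range_le hbound) ?_
  exact ENNReal.mul_lt_top (by simp) ENNReal.ofReal_lt_top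

end IsSpectralFamily

/-- If `E` is a spectral measure (normalized and multiplicative, hence
projection valued), then `D²(f,E) = D(f,E)` for every measurable `f : Ω → ℂ`: `f` is
`E_{ψ,φ}`-integrable for every `ψ` if and only if `|f|²` is `E_{φ,φ}`-integrable. -/
theorem stmt3 {Ω : Type*} [MeasurableSpace Ω] {H : Type*} [NormedAddCommGroup H]
    [InnerProductSpace ℂ H] [CompleteSpace H]
    (E : Set Ω → H →L[ℂ] H) (hEpos : ∀ B : Set Ω, MeasurableSet B → (E B).IsPositive)
    (hEone : E Set.univ = 1)
    (hEmul : ∀ A B : Set Ω, MeasurableSet A → MeasurableSet B →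
      E (A ∩ B) = (E A).comp (E B))
    (ν : H → H → MeasureTheory.ComplexMeasure Ω)
    (hν : ∀ (ψ φ : H) (B : Set Ω), MeasurableSet B → ν ψ φ B = ⟪ψ, E B φ⟫)
    (f : Ω → ℂ) (hf : Measurable f) :
    ∀ φ : H, (Integrable (fun x => ‖f x‖ ^ 2) (ν φ φ).tv ↔
      ∀ ψ : H, (ν ψ φ).CIntegrable f) := by
  intro φ
  have hE : IsSpectralFamily E ν := ⟨hEpos, hEmul, hν⟩
  have hfloor : Measurable fun x => ⌊‖f x‖⌋₊ := Nat.measurable_floor.comp hf.norm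
  have hfloor_le (x : Ω) : (⌊‖f x‖⌋₊ : ℝ) ≤ ‖f x‖ := Nat.floor_le (norm_nonneg _)
  have hle_floor (x : Ω) : ‖f x‖ ≤ ⌊‖f x‖⌋₊ + 1 := (Nat.lt_floor_add_one _).le
  have hcast (k : ℕ) : (k : ℝ≥0∞) = ENNReal.ofReal k := (ENNReal.ofReal_natCast k).symm
  constructor
  · intro h ψ
    refine ⟨hf.aestronglyMeasurable, ?_⟩
    have hn : Measurable fun x => ⌊‖f x‖⌋₊ + 1 := hfloor.add_const 1
    have hsq : ∫⁻ x, ((⌊‖f x‖⌋₊ + 1 : ℕ) : ℝ≥0∞) ^ 2 ∂(ν φ φ).tv < ∞ := by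
      refine lt_of_le_of_lt (lintegral_mono fun x => ?_)
        ((h.const_mul 2).add (integrable_const (2 : ℝ))).hasFiniteIntegral
      rw [hcast, ← ENNReal.ofReal_pow (Nat.cast_nonneg _), ← ofReal_norm]
      refine ENNReal.ofReal_le_ofReal (le_trans ?_ (le_abs_self _))
      have := hfloor_le x
      simp only [Pi.add_apply]
      push_cast
      nlinarith [sq_nonneg (‖f x‖ - 1), Nat.cast_nonneg (α := ℝ) ⌊‖f x‖⌋₊]
    refine lt_of_le_of_lt (lintegral_mono fun x => ?_)
      ((hE.lintegral_natCast_le hn ψ φ).trans_lt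
        (ENNReal.mul_lt_top (by simp) (ENNReal.add_lt_top.2 ⟨measure_lt_top _ _, hsq⟩)))
    rw [hcast, ← ofReal_norm]
    refine ENNReal.ofReal_le_ofReal ?_
    push_cast
    exact hle_floor x
  · intro h
    refine ⟨(hf.norm.pow_const 2).aestronglyMeasurable, ?_⟩
    have hsq := hE.lintegral_natCast_sq_lt_top hfloor φ fun ψ => by
      refine lt_of_le_of_lt (lintegral_mono fun x => ?_) (h ψ).hasFiniteIntegral
      rw [hcast, ← ofReal_norm]
      exact ENNReal.ofReal_le_ofReal (hfloor_le x)
    have hfin : ∫⁻ x, (2 * (⌊‖f x‖⌋₊ : ℝ≥0∞) ^ 2 + 2) ∂(ν φ φ).tv < ∞ := by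
      rw [lintegral_add_right _ measurable_const, lintegral_const_mul' _ _ (by simp),
        lintegral_const]
      exact ENNReal.add_lt_top.2 ⟨ENNReal.mul_lt_top (by simp) hsq,
        ENNReal.mul_lt_top (by simp) (measure_lt_top _ _)⟩
    refine lt_of_le_of_lt (lintegral_mono fun x => ?_) hfin
    rw [hcast, ← ENNReal.ofReal_pow (Nat.cast_nonneg _), ← ofReal_norm,
      ← ENNReal.ofReal_ofNat 2, ← ENNReal.ofReal_mul (by norm_num),
      ← ENNReal.ofReal_add (by positivity) (by norm_num), norm_pow, norm_norm]
    refine ENNReal.ofReal_le_ofReal ?_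
    nlinarith [hle_floor x, norm_nonneg (f x), sq_nonneg ((⌊‖f x‖⌋₊ : ℝ) - 1)]
end
end

section
/- Let E : 𝒜 → L(H) be a positive operator measure and f : Ω → ℂ a measurable function. Then D(f,E) = {φ ∈ H : the limit lim_{n→∞} L(χ_B·f̃_n, E)φ exists in norm for every B ∈ 𝒜}, and L(f,E)φ = lim_{n→∞} L(f̃_n, E)φ for every φ ∈ D(f,E). -/
open MeasureTheory Filter Topology ComplexConjugate

noncomputable section

local notation "⟪" x ", " y "⟫" => @inner ℂ _ _ x y

/-- The truncation `f̃ₙ` of `f` : `f̃ₙ(x) = f(x)` if `|f(x)| ≤ n`, and `f̃ₙ(x) = 0` otherwise. -/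
def trunc {Ω : Type*} (f : Ω → ℂ) (n : ℕ) : Ω → ℂ :=
  fun x => if ‖f x‖ ≤ (n : ℝ) then f x else 0

/-- Any sequence of vectors admits signed partial sums whose squared norms dominate the sums of the
squared norms of the vectors. -/
theorem exists_signed_partial_sums {H : Type*} [NormedAddCommGroup H] [InnerProductSpace ℂ H]
    (y : ℕ → H) : ∃ S : ℕ → H, S 0 = 0 ∧ ∀ k,
      (S (k + 1) = S k + y k ∨ S (k + 1) = S k - y k) ∧
        ‖S k‖ ^ 2 + ‖y k‖ ^ 2 ≤ ‖S (k + 1)‖ ^ 2 := by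
  have step : ∀ (k : ℕ) (s : H), ∃ t : H, (t = s + y k ∨ t = s - y k) ∧
      ‖s‖ ^ 2 + ‖y k‖ ^ 2 ≤ ‖t‖ ^ 2 := by
    intro k s
    rcases le_total 0 (RCLike.re (inner ℂ s (y k))) with h | h
    · refine ⟨s + y k, Or.inl rfl, ?_⟩
      rw [@norm_add_sq ℂ]
      linarith
    · refine ⟨s - y k, Or.inr rfl, ?_⟩
      rw [@norm_sub_sq ℂ]
      linarith
  choose next hnext using step
  exact ⟨fun n => Nat.rec 0 next n, rfl, fun k => hnext k _⟩

/-- A sequence in a Hilbert space all of whose scalar projections have bounded variation is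
Cauchy in norm. -/
theorem cauchySeq_of_weak_bounded_variation {H : Type*} [NormedAddCommGroup H]
    [InnerProductSpace ℂ H] [CompleteSpace H] (u : ℕ → H)
    (hu : ∀ ψ : H, ∃ (v : ℕ → ℝ) (C : ℝ), (∀ n, v n ≤ C) ∧
      ∀ n m, n ≤ m → ‖⟪ψ, u m - u n⟫‖ ≤ v m - v n) : CauchySeq u := by
  rw [Metric.cauchySeq_iff']
  by_contra! hcon
  obtain ⟨ε, hε, hcon⟩ := hcon
  choose g hg hgε using hcon
  let p : ℕ → ℕ := fun k => g^[k] 0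
  have hp : ∀ k, p (k + 1) = g (p k) := fun k => Function.iterate_succ_apply' g k 0
  let y : ℕ → H := fun k => u (p (k + 1)) - u (p k)
  have hy : ∀ k, ε ≤ ‖y k‖ := by
    intro k
    have := hgε (p k)
    rwa [dist_eq_norm, ← hp] at this
  obtain ⟨S, hS0, hS⟩ := exists_signed_partial_sums y
  have hweak : ∀ ψ : H, ∃ C, ∀ n, ‖innerSL ℂ (S n) ψ‖ ≤ C := by
    intro ψ
    obtain ⟨v, C, hvC, hv⟩ := hu ψ
    refine ⟨C - v (p 0), fun n => ?_⟩
    have key : ‖⟪ψ, S n⟫‖ ≤ v (p n) - v (p 0) := by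
      induction n with
      | zero => simp [hS0]
      | succ k ih =>
        have h1 : ‖⟪ψ, y k⟫‖ ≤ v (p (k + 1)) - v (p k) :=
          hv _ _ (by rw [hp]; exact hg _)
        have h2 : ‖⟪ψ, S (k + 1)⟫‖ ≤ ‖⟪ψ, S k⟫‖ + ‖⟪ψ, y k⟫‖ := by
          rcases (hS k).1 with h | h
          · rw [h, inner_add_right]; exact norm_add_le _ _
          · rw [h, inner_sub_right]; exact norm_sub_le _ _
        linarith
    rw [innerSL_apply_apply, norm_inner_symm]
    linarith [hvC (p n)]
  obtain ⟨C, hC⟩ := banach_steinhaus hweak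
  have hlow : ∀ n : ℕ, n * ε ^ 2 ≤ ‖S n‖ ^ 2 := by
    intro n
    induction n with
    | zero => simp
    | succ k ih =>
      have h1 : ε ^ 2 ≤ ‖y k‖ ^ 2 := pow_le_pow_left₀ hε.le (hy k) 2
      have := (hS k).2
      push_cast
      linarith
  obtain ⟨n, hn⟩ := exists_nat_gt (C ^ 2 / ε ^ 2)
  rw [div_lt_iff₀ (by positivity)] at hn
  have h1 : ‖S n‖ ≤ C := by
    have := hC n
    rwa [innerSL_apply_norm] at this
  have h2 : ‖S n‖ ^ 2 ≤ C ^ 2 := pow_le_pow_left₀ (norm_nonneg _) h1 2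
  linarith [hlow n]

theorem MeasureTheory.Measure.MutuallySingular.ae_rnDeriv_eq_zero_or {Ω : Type*}
    [MeasurableSpace Ω] {p q μ : Measure Ω} (h : p ⟂ₘ q) :
    ∀ᵐ x ∂μ, p.rnDeriv μ x = 0 ∨ q.rnDeriv μ x = 0 := by
  obtain ⟨s, hs, hps, hqs⟩ := h
  have h1 : ∀ᵐ x ∂μ, x ∈ s → p.rnDeriv μ x = 0 := by
    rw [← setLIntegral_eq_zero_iff hs (Measure.measurable_rnDeriv _ _)]
    exact le_antisymm ((Measure.setLIntegral_rnDeriv_le s).trans hps.le) zero_le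
  have h2 : ∀ᵐ x ∂μ, x ∈ sᶜ → q.rnDeriv μ x = 0 := by
    rw [← setLIntegral_eq_zero_iff hs.compl (Measure.measurable_rnDeriv _ _)]
    exact le_antisymm ((Measure.setLIntegral_rnDeriv_le sᶜ).trans hqs.le) zero_le
  filter_upwards [h1, h2] with x hx1 hx2
  by_cases hx : x ∈ s
  · exact Or.inl (hx1 hx)
  · exact Or.inr (hx2 hx)

instance {Ω : Type*} [MeasurableSpace Ω] (ν : ComplexMeasure Ω) : IsFiniteMeasure ν.tv := by
  unfold ComplexMeasure.tv SignedMeasure.totalVariation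
  infer_instance

/-- A signed measure whose total variation is dominated by `μ` has a bounded real density. -/
theorem MeasureTheory.SignedMeasure.exists_density {Ω : Type*} [MeasurableSpace Ω]
    (σ : SignedMeasure Ω) (μ : Measure Ω) [IsFiniteMeasure μ] (hσ : σ.totalVariation ≤ μ) :
    ∃ k : Ω → ℝ, Measurable k ∧ (∀ᵐ x ∂μ, |k x| = (σ.totalVariation.rnDeriv μ x).toReal) ∧
      (∀ᵐ x ∂μ, |k x| ≤ 1) ∧
      ∀ F : Ω → ℂ, Integrable F μ → σ.cintegral F = ∫ x, k x • F x ∂μ := by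
  set p := σ.toJordanDecomposition.posPart with hp
  set q := σ.toJordanDecomposition.negPart with hq
  have htv : σ.totalVariation = p + q := rfl
  have hfin : IsFiniteMeasure σ.totalVariation := by rw [htv]; infer_instance
  have hpμ : p ≤ μ := le_trans (by rw [htv]; exact Measure.le_add_right le_rfl) hσ
  have hqμ : q ≤ μ := le_trans (by rw [htv]; exact Measure.le_add_left le_rfl) hσ
  have habs : ∀ᵐ x ∂μ, |(p.rnDeriv μ x).toReal - (q.rnDeriv μ x).toReal| =
      (σ.totalVariation.rnDeriv μ x).toReal := by
    have hsing : p ⟂ₘ q := σ.toJordanDecomposition.mutuallySingular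
    filter_upwards [hsing.ae_rnDeriv_eq_zero_or (μ := μ), Measure.rnDeriv_add' p q μ]
      with x hx hadd
    rw [htv, hadd, Pi.add_apply]
    rcases hx with hx | hx <;> simp [hx]
  refine ⟨fun x => (p.rnDeriv μ x).toReal - (q.rnDeriv μ x).toReal, by fun_prop, habs, ?_, ?_⟩
  · filter_upwards [habs, Measure.rnDeriv_le_one_of_le hσ] with x hx hle
    rw [hx]
    exact ENNReal.toReal_le_of_le_ofReal zero_le_one (by simpa using hle)
  · intro F hF
    have hp' := Measure.absolutelyContinuous_of_le hpμ
    have hq' := Measure.absolutelyContinuous_of_le hqμ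
    simp only [sub_smul]
    rw [integral_sub, integral_rnDeriv_smul hp', integral_rnDeriv_smul hq']
    · rfl
    · exact (integrable_rnDeriv_smul_iff hp').2 (hF.mono_measure hpμ)
    · exact (integrable_rnDeriv_smul_iff hq').2 (hF.mono_measure hqμ)

/-- A complex measure has a density with respect to `tv` that is bounded above and below. -/
theorem MeasureTheory.ComplexMeasure.exists_density {Ω : Type*} [MeasurableSpace Ω]
    (ν : ComplexMeasure Ω) :
    ∃ h : Ω → ℂ, Measurable h ∧ (∀ᵐ x ∂ν.tv, 1 ≤ 2 * ‖h x‖) ∧ (∀ᵐ x ∂ν.tv, ‖h x‖ ≤ 2) ∧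
      ∀ F : Ω → ℂ, Integrable F ν.tv → ν.cintegral F = ∫ x, F x * h x ∂ν.tv := by
  set σ := ComplexMeasure.re ν
  set τ := ComplexMeasure.im ν
  have htv : ν.tv = σ.totalVariation + τ.totalVariation := rfl
  obtain ⟨a, ham, haeq, ha1, hai⟩ := σ.exists_density ν.tv
    (by rw [htv]; exact Measure.le_add_right le_rfl)
  obtain ⟨b, hbm, hbeq, hb1, hbi⟩ := τ.exists_density ν.tv
    (by rw [htv]; exact Measure.le_add_left le_rfl)
  have hσf : IsFiniteMeasure σ.totalVariation := by
    unfold SignedMeasure.totalVariation; infer_instance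
  have hτf : IsFiniteMeasure τ.totalVariation := by
    unfold SignedMeasure.totalVariation; infer_instance
  have hsum : ∀ᵐ x ∂ν.tv, |a x| + |b x| = 1 := by
    have hadd := Measure.rnDeriv_add' σ.totalVariation τ.totalVariation ν.tv
    rw [← htv] at hadd
    filter_upwards [haeq, hbeq, hadd, Measure.rnDeriv_self ν.tv,
      Measure.rnDeriv_lt_top σ.totalVariation ν.tv,
      Measure.rnDeriv_lt_top τ.totalVariation ν.tv] with x h1 h2 h3 h4 h5 h6
    rw [h1, h2, ← ENNReal.toReal_add h5.ne h6.ne, ← Pi.add_apply, ← h3, h4]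
    simp
  refine ⟨fun x => (a x : ℂ) + Complex.I * (b x : ℂ), by fun_prop, ?_, ?_, ?_⟩
  · filter_upwards [hsum] with x hx
    have h1 := Complex.abs_re_le_norm ((a x : ℂ) + Complex.I * (b x : ℂ))
    have h2 := Complex.abs_im_le_norm ((a x : ℂ) + Complex.I * (b x : ℂ))
    simp at h1 h2
    linarith
  · filter_upwards [ha1, hb1] with x h1 h2
    refine (norm_add_le _ _).trans ?_
    simp
    linarith
  · intro F hF
    have hint : ∀ k : Ω → ℝ, Measurable k → (∀ᵐ x ∂ν.tv, |k x| ≤ 1) →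
        Integrable (fun x => k x • F x) ν.tv := by
      intro k hk hk1
      simp only [Complex.real_smul]
      refine hF.bdd_mul (c := 1) (f := fun x => (k x : ℂ)) (by fun_prop) ?_
      filter_upwards [hk1] with x hx
      simpa using hx
    change σ.cintegral F + Complex.I * τ.cintegral F = _
    rw [hai F hF, hbi F hF, ← integral_const_mul,
      ← integral_add (hint a ham ha1) ((hint b hbm hb1).const_mul _)]
    refine integral_congr_ae (ae_of_all _ fun x => ?_)
    simp only [Complex.real_smul]
    ring

theorem measurable_trunc {Ω : Type*} [MeasurableSpace Ω] {f : Ω → ℂ} (hf : Measurable f) (n : ℕ) :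
    Measurable (trunc f n) :=
  Measurable.ite (measurableSet_le hf.norm measurable_const) hf measurable_const

theorem norm_trunc_le {Ω : Type*} (f : Ω → ℂ) (n : ℕ) (x : Ω) : ‖trunc f n x‖ ≤ n := by
  unfold trunc
  split_ifs with h
  · exact h
  · simp

theorem norm_trunc_le_norm {Ω : Type*} (f : Ω → ℂ) (n : ℕ) (x : Ω) : ‖trunc f n x‖ ≤ ‖f x‖ := by
  unfold trunc
  split_ifs with h <;> simp

theorem norm_trunc_sub {Ω : Type*} (f : Ω → ℂ) {n m : ℕ} (h : n ≤ m) (x : Ω) :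
    ‖trunc f m x - trunc f n x‖ = ‖trunc f m x‖ - ‖trunc f n x‖ := by
  have h' : (n : ℝ) ≤ m := by exact_mod_cast h
  unfold trunc
  split_ifs with h1 h2 h2
  · simp
  · simp
  · linarith
  · simp

theorem trunc_eventually_eq {Ω : Type*} (f : Ω → ℂ) (x : Ω) :
    ∀ᶠ n in atTop, trunc f n x = f x := by
  obtain ⟨N, hN⟩ := exists_nat_ge ‖f x‖
  filter_upwards [eventually_ge_atTop N] with n hn
  exact if_pos (hN.trans (by exact_mod_cast hn))

theorem integrable_trunc {Ω : Type*} [MeasurableSpace Ω] {f : Ω → ℂ} (hf : Measurable f) (n : ℕ)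
    (μ : Measure Ω) [IsFiniteMeasure μ] : Integrable (trunc f n) μ :=
  Integrable.of_bound (measurable_trunc hf n).aestronglyMeasurable n
    (ae_of_all _ (norm_trunc_le f n))

/-- If `f` is integrable, the integrals of the truncations over a measurable set are of bounded
variation in the truncation level. -/
theorem MeasureTheory.ComplexMeasure.CIntegrable.bounded_variation {Ω : Type*} [MeasurableSpace Ω]
    {ν : ComplexMeasure Ω} {f : Ω → ℂ} (hfm : Measurable f) (hf : ν.CIntegrable f)
    {B : Set Ω} (hB : MeasurableSet B) :
    ∃ (v : ℕ → ℝ) (C : ℝ), (∀ n, v n ≤ C) ∧ ∀ n m, n ≤ m →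
      ‖ν.cintegral (B.indicator (trunc f m)) - ν.cintegral (B.indicator (trunc f n))‖
        ≤ v m - v n := by
  obtain ⟨h, hm, -, h2, hint⟩ := ν.exists_density
  have htr := fun n => integrable_trunc hfm n ν.tv
  refine ⟨fun n => ∫ x, ‖trunc f n x‖ * 2 ∂ν.tv, ∫ x, ‖f x‖ * 2 ∂ν.tv, fun n => ?_, ?_⟩
  · exact integral_mono ((htr n).norm.mul_const _) (Integrable.mul_const hf.norm _)
      fun x => by have := norm_trunc_le_norm f n x; dsimp only; linarith
  · intro n m hnm
    have hI := fun n => ((htr n).indicator hB).mul_bdd (c := 2) hm.aestronglyMeasurable h2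
    rw [hint _ ((htr m).indicator hB), hint _ ((htr n).indicator hB),
      ← integral_sub (hI m) (hI n),
      ← integral_sub ((htr m).norm.mul_const _) ((htr n).norm.mul_const _)]
    refine norm_integral_le_of_norm_le
      (((htr m).norm.mul_const _).sub ((htr n).norm.mul_const _)) ?_
    filter_upwards [h2] with x hx
    rw [← sub_mul, ← sub_mul, norm_mul, ← norm_trunc_sub f hnm]
    refine mul_le_mul ?_ hx (norm_nonneg _) (norm_nonneg _)
    by_cases hxB : x ∈ B <;> simp [hxB]

/-- Dominated convergence for the truncations. -/
theorem MeasureTheory.ComplexMeasure.CIntegrable.tendsto_cintegral_trunc {Ω : Type*}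
    [MeasurableSpace Ω] {ν : ComplexMeasure Ω} {f : Ω → ℂ} (hfm : Measurable f)
    (hf : ν.CIntegrable f) :
    Tendsto (fun n => ν.cintegral (trunc f n)) atTop (𝓝 (ν.cintegral f)) := by
  obtain ⟨h, hm, -, h2, hint⟩ := ν.exists_density
  have htr := fun n => integrable_trunc hfm n ν.tv
  rw [hint f hf]
  simp only [fun n => hint _ (htr n)]
  refine tendsto_integral_of_dominated_convergence (fun x => ‖f x‖ * 2)
    (fun n => ((measurable_trunc hfm n).mul hm).aestronglyMeasurable)
    (Integrable.mul_const hf.norm _) (fun n => ?_) (ae_of_all _ fun x => ?_)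
  · filter_upwards [h2] with x hx
    rw [norm_mul]
    exact mul_le_mul (norm_trunc_le_norm f n x) hx (norm_nonneg _) (norm_nonneg _)
  · refine tendsto_const_nhds.congr' ?_
    filter_upwards [trunc_eventually_eq f x] with n hn
    rw [hn]

/-- If the integrals of the truncations over each measurable set are bounded, then `f` is
integrable. -/
theorem MeasureTheory.ComplexMeasure.CIntegrable.of_bounded {Ω : Type*} [MeasurableSpace Ω]
    {ν : ComplexMeasure Ω} {f : Ω → ℂ} (hfm : Measurable f)
    (hbdd : ∀ B, MeasurableSet B → ∃ C, ∀ n, ‖ν.cintegral (B.indicator (trunc f n))‖ ≤ C) :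
    ν.CIntegrable f := by
  obtain ⟨h, hm, h1, h2, hint⟩ := ν.exists_density
  have htr := fun n => integrable_trunc hfm n ν.tv
  have hfin : ∀ c : ℂ, ∫⁻ x, ENNReal.ofReal (c * (f x * h x)).re ∂ν.tv < ⊤ := by
    intro c
    set B : Set Ω := {x | 0 ≤ (c * (f x * h x)).re} with hBdef
    have hB : MeasurableSet B := measurableSet_le measurable_const (by fun_prop)
    obtain ⟨C, hC⟩ := hbdd B hB
    have hbound : ∀ n, ∫⁻ x, ENNReal.ofReal (c * (trunc f n x * h x)).re ∂ν.tv
        ≤ ENNReal.ofReal (‖c‖ * C) := by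
      intro n
      have hI : Integrable (fun x => c * (B.indicator (trunc f n) x * h x)) ν.tv :=
        (((htr n).indicator hB).mul_bdd (c := 2) hm.aestronglyMeasurable h2).const_mul c
      have hnn : ∀ x, 0 ≤ (c * (B.indicator (trunc f n) x * h x)).re := by
        intro x
        by_cases hx : x ∈ B
        · rw [Set.indicator_of_mem hx]
          unfold trunc
          split_ifs
          · exact hx
          · simp
        · simp [hx]
      calc ∫⁻ x, ENNReal.ofReal (c * (trunc f n x * h x)).re ∂ν.tv
          ≤ ∫⁻ x, ENNReal.ofReal (c * (B.indicator (trunc f n) x * h x)).re ∂ν.tv := by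
            refine lintegral_mono fun x => ENNReal.ofReal_le_ofReal ?_
            by_cases hx : x ∈ B
            · rw [Set.indicator_of_mem hx]
            · rw [Set.indicator_of_notMem hx]
              simp only [zero_mul, mul_zero, Complex.zero_re]
              unfold trunc
              split_ifs
              · exact (not_le.1 hx).le
              · simp
        _ = ENNReal.ofReal (∫ x, (c * (B.indicator (trunc f n) x * h x)).re ∂ν.tv) :=
            (ofReal_integral_eq_lintegral_ofReal hI.re (ae_of_all _ hnn)).symm
        _ ≤ ENNReal.ofReal (‖c‖ * C) := by
            refine ENNReal.ofReal_le_ofReal ?_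
            have hre : ∫ x, (c * (B.indicator (trunc f n) x * h x)).re ∂ν.tv =
                (∫ x, c * (B.indicator (trunc f n) x * h x) ∂ν.tv).re := integral_re hI
            rw [hre, integral_const_mul, ← hint _ ((htr n).indicator hB)]
            refine (Complex.re_le_norm _).trans ?_
            rw [norm_mul]
            exact mul_le_mul_of_nonneg_left (hC n) (norm_nonneg _)
    refine lt_of_le_of_lt ?_ (ENNReal.ofReal_lt_top (r := ‖c‖ * C))
    calc ∫⁻ x, ENNReal.ofReal (c * (f x * h x)).re ∂ν.tv
        = ∫⁻ x, liminf (fun n => ENNReal.ofReal (c * (trunc f n x * h x)).re) atTop ∂ν.tv := by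
          refine lintegral_congr fun x => ?_
          refine (Tendsto.liminf_eq (tendsto_const_nhds.congr' ?_)).symm
          filter_upwards [trunc_eventually_eq f x] with n hn
          rw [hn]
      _ ≤ liminf (fun n => ∫⁻ x, ENNReal.ofReal (c * (trunc f n x * h x)).re ∂ν.tv) atTop :=
          lintegral_liminf_le fun n => by
            have := measurable_trunc hfm n
            fun_prop
      _ ≤ ENNReal.ofReal (‖c‖ * C) :=
          liminf_le_of_le (by isBoundedDefault) fun b hb => by
            obtain ⟨n, hn⟩ := hb.exists
            exact hn.trans (hbound n)
  have hre : ∀ c : ℂ, Integrable (fun x => max (c * (f x * h x)).re 0) ν.tv := by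
    intro c
    refine ⟨by fun_prop, ?_⟩
    rw [hasFiniteIntegral_iff_ofReal
      (Eventually.of_forall fun x => le_max_right (c * (f x * h x)).re 0)]
    refine lt_of_le_of_lt (lintegral_mono fun x => ?_) (hfin c)
    simp [ENNReal.ofReal_max]
  have hdom := (((hre 1).add (hre (-1))).add ((hre Complex.I).add (hre (-Complex.I)))).const_mul 2
  refine Integrable.mono' hdom hfm.aestronglyMeasurable ?_
  filter_upwards [h1] with x hx
  set g := f x * h x with hg
  have hgn : ‖f x‖ ≤ 2 * ‖g‖ := by
    rw [hg, norm_mul]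
    nlinarith [norm_nonneg (f x)]
  have habs : ∀ r : ℝ, |r| = max r 0 + max (-r) 0 := fun r => by
    rcases le_total 0 r with hr | hr
    · simp [abs_of_nonneg hr, hr]
    · simp [abs_of_nonpos hr, hr]
  have hsum := Complex.norm_le_abs_re_add_abs_im g
  rw [habs g.re, habs g.im] at hsum
  refine hgn.trans ?_
  simp only [Pi.add_apply, one_mul, neg_mul, Complex.neg_re, Complex.I_mul_re, neg_neg,
    ← hg]
  linarith

/-- For a positive operator measure `E` and a measurable `f`,
`D(f,E) = {φ | lim_n L(χ_B·f̃ₙ,E)φ exists for every B ∈ 𝒜}`, and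
`L(f,E)φ = lim_n L(f̃ₙ,E)φ` for every `φ ∈ D(f,E)`. Here `Ln n B` is the (bounded) operator
integral of the bounded function `χ_B·f̃ₙ` and `L` is the operator integral of `f` on `D`. -/
theorem stmt4 {Ω : Type*} [MeasurableSpace Ω] {H : Type*} [NormedAddCommGroup H]
    [InnerProductSpace ℂ H] [CompleteSpace H]
    (E : Set Ω → H →L[ℂ] H) (hEpos : ∀ B : Set Ω, MeasurableSet B → (E B).IsPositive)
    (ν : H → H → MeasureTheory.ComplexMeasure Ω)
    (hν : ∀ (ψ φ : H) (B : Set Ω), MeasurableSet B → ν ψ φ B = ⟪ψ, E B φ⟫)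
    (f : Ω → ℂ) (hf : Measurable f)
    (Ln : ℕ → Set Ω → H →L[ℂ] H)
    (hLn : ∀ (n : ℕ) (B : Set Ω), MeasurableSet B → ∀ ψ φ : H,
      ⟪ψ, Ln n B φ⟫ = (ν ψ φ).cintegral (B.indicator (trunc f n)))
    (D : Submodule ℂ H)
    (hD : (D : Set H) = {φ : H | ∀ ψ : H, (ν ψ φ).CIntegrable f})
    (L : D →ₗ[ℂ] H)
    (hL : ∀ (φ : D) (ψ : H), ⟪ψ, L φ⟫ = (ν ψ (φ : H)).cintegral f) :
    (D : Set H) = {φ : H | ∀ B : Set Ω, MeasurableSet B →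
        ∃ η : H, Tendsto (fun n => Ln n B φ) atTop (𝓝 η)} ∧
      ∀ φ : D, Tendsto (fun n => Ln n Set.univ (φ : H)) atTop (𝓝 (L φ)) := by
  have conv : ∀ φ : H, (∀ ψ : H, (ν ψ φ).CIntegrable f) → ∀ B : Set Ω, MeasurableSet B →
      ∃ η : H, Tendsto (fun n => Ln n B φ) atTop (𝓝 η) := by
    intro φ hφ B hB
    refine cauchySeq_tendsto_of_complete (cauchySeq_of_weak_bounded_variation _ fun ψ => ?_)
    obtain ⟨v, C, hvC, hv⟩ := (hφ ψ).bounded_variation hf hB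
    refine ⟨v, C, hvC, fun n m hnm => ?_⟩
    rw [inner_sub_right, hLn m B hB, hLn n B hB]
    exact hv n m hnm
  constructor
  · rw [hD]
    ext φ
    refine ⟨conv φ, fun hφ ψ => .of_bounded hf fun B hB => ?_⟩
    obtain ⟨η, hη⟩ := hφ B hB
    obtain ⟨C, hC⟩ := (Metric.isBounded_range_of_tendsto (fun n => ⟪ψ, Ln n B φ⟫)
      ((tendsto_const_nhds (x := ψ)).inner hη)).exists_norm_le
    refine ⟨C, fun n => ?_⟩
    rw [← hLn n B hB]
    exact hC _ ⟨n, rfl⟩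
  · intro φ
    have hφ : ∀ ψ : H, (ν ψ φ).CIntegrable f := by
      have : (φ : H) ∈ (D : Set H) := φ.2
      rwa [hD] at this
    obtain ⟨η, hη⟩ := conv φ hφ Set.univ MeasurableSet.univ
    suffices η = L φ by rwa [← this]
    refine ext_inner_left ℂ fun ψ => ?_
    refine tendsto_nhds_unique ((tendsto_const_nhds (x := ψ)).inner hη) ?_
    rw [hL]
    simp only [hLn _ _ MeasurableSet.univ, Set.indicator_univ]
    exact (hφ ψ).tendsto_cintegral_trunc hf
end
end
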